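/- arXiv:2601.12411 — 5 statements merged into one kernel-verified Lean document; each statement's English description precedes it below -/
import Mathlib

section
/- Monotonicity of feasibility for prokaryotic RBA: assume the matrices C_Y^M and C_G^M have nonnegative entries. Let μ ≥ 0 and suppose (Y,ν) ∈ F(μ). Then for every μ' with 0 ≤ μ' ≤ μ, the pair (Y, ν') belongs to F(μ'), where ν' = (μ'/μ)·ν if μ > 0 and ν' = 0 if μ = 0. In particular, if F(μ) is nonempty then F(μ') is nonempty for every μ' ∈ [0,μ]. -/
open Matrix

/-- The prokaryotic RBA feasible set `F(μ)`. -/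
def RBAFeas {Ns Nm Np Ng Nb Nc : ℕ}
    (Ω : Matrix (Fin Ns) (Fin Nm) ℝ)
    (CYS : Matrix (Fin Ns) (Fin (Nm + Np)) ℝ)
    (CBS : Matrix (Fin Ns) (Fin Nb) ℝ)
    (CGS : Matrix (Fin Ns) (Fin Ng) ℝ)
    (CYM : Matrix (Fin Np) (Fin (Nm + Np)) ℝ)
    (CGM : Matrix (Fin Np) (Fin Ng) ℝ)
    (KT : Matrix (Fin Np) (Fin (Nm + Np)) ℝ)
    (CYD : Matrix (Fin Nc) (Fin (Nm + Np)) ℝ)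
    (CGD : Matrix (Fin Nc) (Fin Ng) ℝ)
    (k : Fin Nm → ℝ) (B : Fin Nb → ℝ) (PG : Fin Ng → ℝ) (Dbar : Fin Nc → ℝ)
    (μ : ℝ) : Set ((Fin (Nm + Np) → ℝ) × (Fin Nm → ℝ)) :=
  { p | (∀ j, 0 ≤ p.1 j) ∧
        Ω.mulVec p.2 + μ • (CYS.mulVec p.1 + CBS.mulVec B + CGS.mulVec PG) = 0 ∧
        (∀ i, μ * (CYM.mulVec p.1 + CGM.mulVec PG) i ≤ KT.mulVec p.1 i) ∧
        (∀ j : Fin Nm, |p.2 j| ≤ k j * p.1 (Fin.castAdd Np j)) ∧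
        (∀ i, (CYD.mulVec p.1 + CGD.mulVec PG) i ≤ Dbar i) }

/-- Monotonicity of feasibility for prokaryotic RBA. -/
theorem rba_monotonicity {Ns Nm Np Ng Nb Nc : ℕ}
    (Ω : Matrix (Fin Ns) (Fin Nm) ℝ)
    (CYS : Matrix (Fin Ns) (Fin (Nm + Np)) ℝ)
    (CBS : Matrix (Fin Ns) (Fin Nb) ℝ)
    (CGS : Matrix (Fin Ns) (Fin Ng) ℝ)
    (CYM : Matrix (Fin Np) (Fin (Nm + Np)) ℝ)
    (CGM : Matrix (Fin Np) (Fin Ng) ℝ)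
    (KT : Matrix (Fin Np) (Fin (Nm + Np)) ℝ)
    (CYD : Matrix (Fin Nc) (Fin (Nm + Np)) ℝ)
    (CGD : Matrix (Fin Nc) (Fin Ng) ℝ)
    (k : Fin Nm → ℝ) (B : Fin Nb → ℝ) (PG : Fin Ng → ℝ) (Dbar : Fin Nc → ℝ)
    (hk : ∀ j, 0 ≤ k j) (hB : ∀ i, 0 ≤ B i) (hPG : ∀ i, 0 ≤ PG i)
    (hCYM : ∀ i j, 0 ≤ CYM i j) (hCGM : ∀ i j, 0 ≤ CGM i j)
    (μ : ℝ) (hμ : 0 ≤ μ)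
    (Y : Fin (Nm + Np) → ℝ) (ν : Fin Nm → ℝ)
    (hmem : (Y, ν) ∈ RBAFeas Ω CYS CBS CGS CYM CGM KT CYD CGD k B PG Dbar μ)
    (μ' : ℝ) (hμ'0 : 0 ≤ μ') (hμ'μ : μ' ≤ μ) :
    (Y, if μ = 0 then (0 : Fin Nm → ℝ) else (μ' / μ) • ν) ∈
      RBAFeas Ω CYS CBS CGS CYM CGM KT CYD CGD k B PG Dbar μ' ∧
    ((RBAFeas Ω CYS CBS CGS CYM CGM KT CYD CGD k B PG Dbar μ).Nonempty →
      (RBAFeas Ω CYS CBS CGS CYM CGM KT CYD CGD k B PG Dbar μ').Nonempty) := by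
  have key : (Y, if μ = 0 then (0 : Fin Nm → ℝ) else (μ' / μ) • ν) ∈
      RBAFeas Ω CYS CBS CGS CYM CGM KT CYD CGD k B PG Dbar μ' := by
    obtain ⟨h0, h1, h2, h3, h4⟩ := hmem
    dsimp only at h0 h1 h2 h3 h4
    refine ⟨h0, ?_, ?_, ?_, h4⟩
    · dsimp only
      split_ifs with h
      · have h' : μ' = 0 := by linarith
        simp [h']
      · have e : μ' = (μ' / μ) * μ := by field_simp
        rw [Matrix.mulVec_smul]
        have e2 : ∀ v : Fin Ns → ℝ, μ' • v = (μ' / μ) • (μ • v) := by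
          intro v
          rw [smul_smul, ← e]
        rw [e2, ← smul_add, h1, smul_zero]
    · intro i
      refine le_trans (mul_le_mul_of_nonneg_right hμ'μ ?_) (h2 i)
      have a1 : 0 ≤ CYM.mulVec Y i := by
        rw [Matrix.mulVec, dotProduct]
        exact Finset.sum_nonneg fun j _ => mul_nonneg (hCYM i j) (h0 j)
      have a2 : 0 ≤ CGM.mulVec PG i := by
        rw [Matrix.mulVec, dotProduct]
        exact Finset.sum_nonneg fun j _ => mul_nonneg (hCGM i j) (hPG j)
      exact add_nonneg a1 a2
    · intro j
      dsimp only
      split_ifs with h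
      · simpa using mul_nonneg (hk j) (h0 _)
      · refine le_trans ?_ (h3 j)
        rw [Pi.smul_apply, smul_eq_mul, abs_mul, abs_of_nonneg (div_nonneg hμ'0 hμ)]
        exact mul_le_of_le_one_left (abs_nonneg _) (div_le_one_of_le₀ hμ'μ hμ)
  exact ⟨key, fun _ => ⟨_, key⟩⟩
end

section
/- Boundedness of the prokaryotic RBA feasible set: assume C_G^D P_G ≥ 0 componentwise and that the density constraints cover all molecular machines, i.e. there exists δ > 0 such that for every j ∈ {1,…,N_y} there exists i ∈ {1,…,N_c} with (C_Y^D)_{ij} ≥ δ and (C_Y^D)_{i'j} ≥ 0 for all i'. Then for every μ ≥ 0 and every (Y,ν) ∈ F(μ), one has 0 ≤ Y_j ≤ (max_i D̄_i)/δ for all j ∈ {1,…,N_y} and |ν_j| ≤ k_j (max_i D̄_i)/δ for all j ∈ {1,…,N_m}; in particular F(μ) is bounded. -/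
open Matrix

/-- Boundedness of the prokaryotic RBA feasible set. Here `⨆ i, Dbar i` plays the
role of `max_i D̄_i`. -/
theorem rba_feasible_set_bounded {Ns Nm Np Ng Nb Nc : ℕ}
    (Ω : Matrix (Fin Ns) (Fin Nm) ℝ)
    (CYS : Matrix (Fin Ns) (Fin (Nm + Np)) ℝ)
    (CBS : Matrix (Fin Ns) (Fin Nb) ℝ)
    (CGS : Matrix (Fin Ns) (Fin Ng) ℝ)
    (CYM : Matrix (Fin Np) (Fin (Nm + Np)) ℝ)
    (CGM : Matrix (Fin Np) (Fin Ng) ℝ)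
    (KT : Matrix (Fin Np) (Fin (Nm + Np)) ℝ)
    (CYD : Matrix (Fin Nc) (Fin (Nm + Np)) ℝ)
    (CGD : Matrix (Fin Nc) (Fin Ng) ℝ)
    (k : Fin Nm → ℝ) (B : Fin Nb → ℝ) (PG : Fin Ng → ℝ) (Dbar : Fin Nc → ℝ)
    (hk : ∀ j, 0 ≤ k j) (hB : ∀ i, 0 ≤ B i) (hPG : ∀ i, 0 ≤ PG i)
    (hCGDPG : ∀ i, 0 ≤ (CGD.mulVec PG) i)
    (δ : ℝ) (hδ : 0 < δ)
    (hcover : ∀ j : Fin (Nm + Np), ∃ i : Fin Nc, δ ≤ CYD i j)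
    (hCYD : ∀ i j, 0 ≤ CYD i j) :
    (∀ μ : ℝ, 0 ≤ μ →
      ∀ Y : Fin (Nm + Np) → ℝ, ∀ ν : Fin Nm → ℝ,
        (Y, ν) ∈ RBAFeas Ω CYS CBS CGS CYM CGM KT CYD CGD k B PG Dbar μ →
          (∀ j, 0 ≤ Y j ∧ Y j ≤ (⨆ i, Dbar i) / δ) ∧
          (∀ j : Fin Nm, |ν j| ≤ k j * ((⨆ i, Dbar i) / δ))) ∧
    (∀ μ : ℝ, 0 ≤ μ →
      Bornology.IsBounded (RBAFeas Ω CYS CBS CGS CYM CGM KT CYD CGD k B PG Dbar μ)) := by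
  have main : ∀ μ : ℝ, 0 ≤ μ →
      ∀ Y : Fin (Nm + Np) → ℝ, ∀ ν : Fin Nm → ℝ,
        (Y, ν) ∈ RBAFeas Ω CYS CBS CGS CYM CGM KT CYD CGD k B PG Dbar μ →
          (∀ j, 0 ≤ Y j ∧ Y j ≤ (⨆ i, Dbar i) / δ) ∧
          (∀ j : Fin Nm, |ν j| ≤ k j * ((⨆ i, Dbar i) / δ)) := by
    rintro μ - Y ν ⟨hY, -, -, hν, hD⟩
    dsimp only at hY hν hD
    have hub : ∀ j, Y j ≤ (⨆ i, Dbar i) / δ := by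
      intro j
      obtain ⟨i, hi⟩ := hcover j
      rw [le_div_iff₀ hδ]
      have h1 : CYD i j * Y j ≤ (CYD.mulVec Y) i :=
        Finset.single_le_sum (f := fun j => CYD i j * Y j)
          (fun j _ => mul_nonneg (hCYD i j) (hY j)) (Finset.mem_univ j)
      have h2 := hD i
      rw [Pi.add_apply] at h2
      have h3 : Dbar i ≤ ⨆ i, Dbar i := le_ciSup (Set.finite_range Dbar).bddAbove i
      have h4 := mul_le_mul_of_nonneg_right hi (hY j)
      have h5 := hCGDPG i
      linarith
    exact ⟨fun j => ⟨hY j, hub j⟩, fun j =>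
      (hν j).trans (mul_le_mul_of_nonneg_left (hub _) (hk j))⟩
  refine ⟨main, fun μ hμ => ?_⟩
  refine (Metric.isBounded_Icc
    ((fun _ => 0, fun j => -(k j * ((⨆ i, Dbar i) / δ))) :
      (Fin (Nm + Np) → ℝ) × (Fin Nm → ℝ))
    (fun _ => (⨆ i, Dbar i) / δ, fun j => k j * ((⨆ i, Dbar i) / δ))).subset ?_
  rintro ⟨Y, ν⟩ h
  obtain ⟨h1, h2⟩ := main μ hμ Y ν h
  exact ⟨⟨fun j => (h1 j).1, fun j => (abs_le.1 (h2 j)).1⟩,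
    ⟨fun j => (h1 j).2, fun j => (abs_le.1 (h2 j)).2⟩⟩
end

section
/- Infeasibility of prokaryotic RBA for large growth rates: assume the matrices C_Y^M, C_G^M and K_T have nonnegative entries, C_G^D P_G ≥ 0 componentwise, there exists δ > 0 such that for every j ∈ {1,…,N_y} there exists i with (C_Y^D)_{ij} ≥ δ and all entries of C_Y^D are nonnegative, and there exists an index i₀ ∈ {1,…,N_p} with (C_G^M P_G)_{i₀} > 0. Let R := max_i D̄_i and κ := Σ_{j=1}^{N_y} (K_T)_{i₀ j}. Then for every μ > (R/δ)·κ / (C_G^M P_G)_{i₀}, the set F(μ) is empty. -/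
open Matrix

/-- Infeasibility of prokaryotic RBA for large growth rates. Here `⨆ i, Dbar i`
plays the role of `R = max_i D̄_i`, and `κ = ∑ j, KT i₀ j`. -/
theorem rba_infeasible_large_growth {Ns Nm Np Ng Nb Nc : ℕ}
    (Ω : Matrix (Fin Ns) (Fin Nm) ℝ)
    (CYS : Matrix (Fin Ns) (Fin (Nm + Np)) ℝ)
    (CBS : Matrix (Fin Ns) (Fin Nb) ℝ)
    (CGS : Matrix (Fin Ns) (Fin Ng) ℝ)
    (CYM : Matrix (Fin Np) (Fin (Nm + Np)) ℝ)
    (CGM : Matrix (Fin Np) (Fin Ng) ℝ)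
    (KT : Matrix (Fin Np) (Fin (Nm + Np)) ℝ)
    (CYD : Matrix (Fin Nc) (Fin (Nm + Np)) ℝ)
    (CGD : Matrix (Fin Nc) (Fin Ng) ℝ)
    (k : Fin Nm → ℝ) (B : Fin Nb → ℝ) (PG : Fin Ng → ℝ) (Dbar : Fin Nc → ℝ)
    (hk : ∀ j, 0 ≤ k j) (hB : ∀ i, 0 ≤ B i) (hPG : ∀ i, 0 ≤ PG i)
    (hCYM : ∀ i j, 0 ≤ CYM i j) (hCGM : ∀ i j, 0 ≤ CGM i j)
    (hKT : ∀ i j, 0 ≤ KT i j)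
    (hCGDPG : ∀ i, 0 ≤ (CGD.mulVec PG) i)
    (δ : ℝ) (hδ : 0 < δ)
    (hcover : ∀ j : Fin (Nm + Np), ∃ i : Fin Nc, δ ≤ CYD i j)
    (hCYD : ∀ i j, 0 ≤ CYD i j)
    (i₀ : Fin Np) (hi₀ : 0 < (CGM.mulVec PG) i₀) :
    ∀ μ : ℝ,
      ((⨆ i, Dbar i) / δ) * (∑ j, KT i₀ j) / (CGM.mulVec PG) i₀ < μ →
      RBAFeas Ω CYS CBS CGS CYM CGM KT CYD CGD k B PG Dbar μ = ∅ := by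
  intro μ hμ
  rw [Set.eq_empty_iff_forall_notMem]
  rintro ⟨Y, ν⟩ ⟨hY, -, hII, -, hIV⟩
  simp only [Pi.add_apply] at hY hII hIV
  have hb : ∀ j, Y j ≤ (⨆ i, Dbar i) / δ := by
    intro j
    obtain ⟨i, hi⟩ := hcover j
    rw [le_div_iff₀ hδ]
    have h1 : CYD i j * Y j ≤ (CYD.mulVec Y) i := by
      simp only [Matrix.mulVec, dotProduct]
      exact Finset.single_le_sum (f := fun j => CYD i j * Y j)
        (fun j _ => mul_nonneg (hCYD i j) (hY j)) (Finset.mem_univ j)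
    have h2 : Dbar i ≤ ⨆ i, Dbar i := le_ciSup (Set.finite_range Dbar).bddAbove i
    have h3 := mul_le_mul_of_nonneg_right hi (hY j)
    have h4 := hIV i
    have h5 := hCGDPG i
    linarith
  have hR : 0 ≤ (⨆ i, Dbar i) / δ := (hY (Fin.natAdd Nm i₀)).trans (hb _)
  have hκ : 0 ≤ ∑ j, KT i₀ j := Finset.sum_nonneg fun j _ => hKT i₀ j
  have hμ0 : 0 < μ := lt_of_le_of_lt (div_nonneg (mul_nonneg hR hκ) hi₀.le) hμ
  rw [div_lt_iff₀ hi₀] at hμ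
  have h1 : (KT.mulVec Y) i₀ ≤ ((⨆ i, Dbar i) / δ) * ∑ j, KT i₀ j := by
    simp only [Matrix.mulVec, dotProduct]
    rw [mul_comm, Finset.sum_mul]
    exact Finset.sum_le_sum fun j _ => mul_le_mul_of_nonneg_left (hb j) (hKT i₀ j)
  have h2 : 0 ≤ (CYM.mulVec Y) i₀ := by
    simp only [Matrix.mulVec, dotProduct]
    exact Finset.sum_nonneg fun j _ => mul_nonneg (hCYM i₀ j) (hY j)
  have h3 := hII i₀
  have h4 := mul_nonneg hμ0.le h2
  rw [mul_add] at h3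
  linarith
end

section
/- Existence of a maximal growth rate for prokaryotic RBA: assume the matrices C_Y^M, C_G^M and K_T have nonnegative entries, C_G^D P_G ≥ 0 and C_G^D P_G ≤ D̄ componentwise, there exists δ > 0 such that for every j ∈ {1,…,N_y} there exists i with (C_Y^D)_{ij} ≥ δ and all entries of C_Y^D are nonnegative, and there exists i₀ ∈ {1,…,N_p} with (C_G^M P_G)_{i₀} > 0. Then the quantity μ_max := sup { μ ≥ 0 : F(μ) ≠ ∅ } is finite, F(μ) is nonempty for every μ ∈ [0, μ_max] (in particular the supremum is attained), and F(μ) is empty for every μ > μ_max. -/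
open Matrix

/-- Existence of a maximal growth rate for prokaryotic RBA: the set of feasible
growth rates is bounded above (so its supremum `μ_max` is finite), `F(μ)` is
nonempty for every `μ ∈ [0, μ_max]` (in particular the supremum is attained), and
`F(μ)` is empty for every `μ > μ_max`. -/
theorem rba_maximal_growth_rate {Ns Nm Np Ng Nb Nc : ℕ}
    (Ω : Matrix (Fin Ns) (Fin Nm) ℝ)
    (CYS : Matrix (Fin Ns) (Fin (Nm + Np)) ℝ)
    (CBS : Matrix (Fin Ns) (Fin Nb) ℝ)
    (CGS : Matrix (Fin Ns) (Fin Ng) ℝ)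
    (CYM : Matrix (Fin Np) (Fin (Nm + Np)) ℝ)
    (CGM : Matrix (Fin Np) (Fin Ng) ℝ)
    (KT : Matrix (Fin Np) (Fin (Nm + Np)) ℝ)
    (CYD : Matrix (Fin Nc) (Fin (Nm + Np)) ℝ)
    (CGD : Matrix (Fin Nc) (Fin Ng) ℝ)
    (k : Fin Nm → ℝ) (B : Fin Nb → ℝ) (PG : Fin Ng → ℝ) (Dbar : Fin Nc → ℝ)
    (hk : ∀ j, 0 ≤ k j) (hB : ∀ i, 0 ≤ B i) (hPG : ∀ i, 0 ≤ PG i)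
    (hCYM : ∀ i j, 0 ≤ CYM i j) (hCGM : ∀ i j, 0 ≤ CGM i j)
    (hKT : ∀ i j, 0 ≤ KT i j)
    (hCGDPG : ∀ i, 0 ≤ (CGD.mulVec PG) i)
    (hadm : ∀ i, (CGD.mulVec PG) i ≤ Dbar i)
    (δ : ℝ) (hδ : 0 < δ)
    (hcover : ∀ j : Fin (Nm + Np), ∃ i : Fin Nc, δ ≤ CYD i j)
    (hCYD : ∀ i j, 0 ≤ CYD i j)
    (i₀ : Fin Np) (hi₀ : 0 < (CGM.mulVec PG) i₀) :
    BddAbove {μ : ℝ | 0 ≤ μ ∧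
        (RBAFeas Ω CYS CBS CGS CYM CGM KT CYD CGD k B PG Dbar μ).Nonempty} ∧
    (∀ μ : ℝ, 0 ≤ μ →
      μ ≤ sSup {μ : ℝ | 0 ≤ μ ∧
        (RBAFeas Ω CYS CBS CGS CYM CGM KT CYD CGD k B PG Dbar μ).Nonempty} →
      (RBAFeas Ω CYS CBS CGS CYM CGM KT CYD CGD k B PG Dbar μ).Nonempty) ∧
    (∀ μ : ℝ,
      sSup {μ : ℝ | 0 ≤ μ ∧
        (RBAFeas Ω CYS CBS CGS CYM CGM KT CYD CGD k B PG Dbar μ).Nonempty} < μ →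
      RBAFeas Ω CYS CBS CGS CYM CGM KT CYD CGD k B PG Dbar μ = ∅) := by
  set F := RBAFeas Ω CYS CBS CGS CYM CGM KT CYD CGD k B PG Dbar with hF
  set M : ℝ := (∑ i, |Dbar i|) / δ with hM
  set U : ℝ := (∑ j, KT i₀ j * M) / (CGM.mulVec PG) i₀ with hU
  have hY : ∀ μ p, p ∈ F μ → ∀ j, p.1 j ≤ M := by
    rintro μ p ⟨h0, -, -, -, h4⟩ j
    obtain ⟨i, hi⟩ := hcover j
    have h1 : CYD i j * p.1 j ≤ (CYD.mulVec p.1) i := by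
      simp only [Matrix.mulVec, dotProduct]
      exact Finset.single_le_sum (f := fun j => CYD i j * p.1 j)
        (fun j _ => mul_nonneg (hCYD i j) (h0 j)) (Finset.mem_univ j)
    have h2 := h4 i
    rw [Pi.add_apply] at h2
    have h3 := hCGDPG i
    have h5 : |Dbar i| ≤ ∑ i, |Dbar i| :=
      Finset.single_le_sum (f := fun i => |Dbar i|) (fun i _ => abs_nonneg _) (Finset.mem_univ i)
    have h6 := le_abs_self (Dbar i)
    have h7 := mul_le_mul_of_nonneg_right hi (h0 j)
    rw [hM, le_div_iff₀ hδ]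
    linarith
  have hμ : ∀ μ p, 0 ≤ μ → p ∈ F μ → μ ≤ U := by
    intro μ p hμ0 hp
    have hYp := hY μ p hp
    obtain ⟨h0, -, h2, -, -⟩ := hp
    have h3 := h2 i₀
    rw [Pi.add_apply] at h3
    have h4 : 0 ≤ (CYM.mulVec p.1) i₀ := by
      simp only [Matrix.mulVec, dotProduct]
      exact Finset.sum_nonneg fun j _ => mul_nonneg (hCYM i₀ j) (h0 j)
    have h5 : (KT.mulVec p.1) i₀ ≤ ∑ j, KT i₀ j * M := by
      simp only [Matrix.mulVec, dotProduct]
      exact Finset.sum_le_sum fun j _ => mul_le_mul_of_nonneg_left (hYp j) (hKT i₀ j)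
    rw [hU, le_div_iff₀ hi₀]
    nlinarith [mul_nonneg hμ0 h4]
  have hdown : ∀ μ ν : ℝ, 0 ≤ ν → ν ≤ μ → (F μ).Nonempty → (F ν).Nonempty := by
    rintro μ ν hν hle ⟨p, h0, h1, h2, h3, h4⟩
    rcases eq_or_lt_of_le (hν.trans hle) with h | hpos
    · have : ν = μ := by linarith
      subst this
      exact ⟨p, h0, h1, h2, h3, h4⟩
    have ht0 : 0 ≤ ν / μ := div_nonneg hν hpos.le
    have ht1 : ν / μ ≤ 1 := (div_le_one hpos).2 hle
    have hν' : ν = (ν / μ) * μ := by field_simp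
    refine ⟨(p.1, (ν / μ) • p.2), h0, ?_, ?_, ?_, h4⟩
    · have := congrArg (fun v => (ν / μ) • v) h1
      simp only [smul_add, smul_smul, smul_zero] at this
      rw [← hν'] at this
      simpa only [Matrix.mulVec_smul, smul_add] using this
    · intro i
      refine le_trans (mul_le_mul_of_nonneg_right hle ?_) (h2 i)
      rw [Pi.add_apply]
      simp only [Matrix.mulVec, dotProduct]
      exact add_nonneg (Finset.sum_nonneg fun j _ => mul_nonneg (hCYM i j) (h0 j))
        (Finset.sum_nonneg fun j _ => mul_nonneg (hCGM i j) (hPG j))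
    · intro j
      refine le_trans ?_ (h3 j)
      simp only [Pi.smul_apply, smul_eq_mul, abs_mul, abs_of_nonneg ht0]
      exact mul_le_of_le_one_left (abs_nonneg _) ht1
  have hzero : (F 0).Nonempty := by
    refine ⟨(0, 0), ?_, ?_, ?_, ?_, ?_⟩
    · simp
    · simp
    · simp
    · simp
    · simpa using hadm
  set S : Set ℝ := {μ : ℝ | 0 ≤ μ ∧ (F μ).Nonempty} with hS
  have hbdd : BddAbove S := ⟨U, fun μ ⟨h0, p, hp⟩ => hμ μ p h0 hp⟩
  let T : Set (ℝ × ((Fin (Nm + Np) → ℝ) × (Fin Nm → ℝ))) := {q | 0 ≤ q.1 ∧ q.2 ∈ F q.1}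
  have hTclosed : IsClosed T := by
    have e : T = {q | 0 ≤ q.1} ∩ ({q | ∀ j, 0 ≤ q.2.1 j} ∩
        ({q | Ω.mulVec q.2.2 + q.1 • (CYS.mulVec q.2.1 + CBS.mulVec B + CGS.mulVec PG) = 0} ∩
        ({q | ∀ i, q.1 * (CYM.mulVec q.2.1 + CGM.mulVec PG) i ≤ KT.mulVec q.2.1 i} ∩
        ({q | ∀ j : Fin Nm, |q.2.2 j| ≤ k j * q.2.1 (Fin.castAdd Np j)} ∩
        {q | ∀ i, (CYD.mulVec q.2.1 + CGD.mulVec PG) i ≤ Dbar i})))) := rfl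
    have hc : ∀ {a b : ℕ} (A : Matrix (Fin a) (Fin b) ℝ), Continuous fun v => A.mulVec v :=
      fun A => Continuous.matrix_mulVec continuous_const continuous_id
    have c1 : ∀ {a : ℕ} (A : Matrix (Fin a) (Fin (Nm + Np)) ℝ), Continuous
        fun q : ℝ × ((Fin (Nm + Np) → ℝ) × (Fin Nm → ℝ)) => A.mulVec q.2.1 :=
      fun A => (hc A).comp (by fun_prop)
    have c2 : ∀ {a : ℕ} (A : Matrix (Fin a) (Fin Nm) ℝ), Continuous
        fun q : ℝ × ((Fin (Nm + Np) → ℝ) × (Fin Nm → ℝ)) => A.mulVec q.2.2 :=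
      fun A => (hc A).comp (by fun_prop)
    have d1 := c1 CYS
    have d2 := c1 CYM
    have d3 := c1 KT
    have d4 := c1 CYD
    have d5 := c2 Ω
    rw [e]
    simp only [Set.ofPred_forall]
    refine IsClosed.inter ?_ (IsClosed.inter ?_ (IsClosed.inter ?_ (IsClosed.inter ?_
      (IsClosed.inter ?_ ?_))))
    · exact isClosed_le continuous_const continuous_fst
    · exact isClosed_iInter fun j => isClosed_le continuous_const (by fun_prop)
    · exact isClosed_eq (by fun_prop) continuous_const
    · exact isClosed_iInter fun i => isClosed_le
        (continuous_fst.mul ((continuous_apply i).comp (d2.add continuous_const)))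
        ((continuous_apply i).comp d3)
    · exact isClosed_iInter fun j => isClosed_le (by fun_prop) (by fun_prop)
    · exact isClosed_iInter fun i => isClosed_le
        ((continuous_apply i).comp (d4.add continuous_const)) continuous_const
  have hTcompact : IsCompact T := by
    refine IsCompact.of_isClosed_subset
      (s := Set.Icc 0 U ×ˢ (Set.Icc (fun _ => 0) (fun _ => M) ×ˢ
        Set.Icc (fun j => -(k j * M)) (fun j => k j * M)))
      (isCompact_Icc.prod (isCompact_Icc.prod isCompact_Icc)) hTclosed ?_
    rintro ⟨μ, p⟩ ⟨h0, hp⟩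
    have hYp := hY μ p hp
    have hb : ∀ j, |p.2 j| ≤ k j * M := fun j =>
      (hp.2.2.2.1 j).trans (mul_le_mul_of_nonneg_left (hYp _) (hk j))
    exact ⟨⟨h0, hμ μ p h0 hp⟩, ⟨hp.1, hYp⟩, fun j => (abs_le.1 (hb j)).1,
      fun j => (abs_le.1 (hb j)).2⟩
  have hST : S = Prod.fst '' T := by
    ext μ
    constructor
    · rintro ⟨h0, p, hp⟩
      exact ⟨(μ, p), ⟨h0, hp⟩, rfl⟩
    · rintro ⟨⟨μ, p⟩, ⟨h0, hp⟩, rfl⟩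
      exact ⟨h0, p, hp⟩
  have hScompact : IsCompact S := hST ▸ hTcompact.image continuous_fst
  have hSmem : sSup S ∈ S := hScompact.sSup_mem ⟨0, le_rfl, hzero⟩
  refine ⟨hbdd, fun μ h0 hle => hdown _ μ h0 hle hSmem.2, fun μ hlt => ?_⟩
  rw [← Set.not_nonempty_iff_eq_empty]
  intro hne
  exact absurd (le_csSup hbdd ⟨hSmem.1.trans hlt.le, hne⟩) (not_le.2 hlt)
end

section
/- Closedness of the set of feasible growth rates for prokaryotic RBA: assume C_G^D P_G ≥ 0 componentwise and that there exists δ > 0 such that for every j ∈ {1,…,N_y} there exists i with (C_Y^D)_{ij} ≥ δ and all entries of C_Y^D are nonnegative. Then the set M := { μ ≥ 0 : F(μ) ≠ ∅ } is closed in ℝ; i.e., if μ_n ∈ M and μ_n → μ ≥ 0, then μ ∈ M. -/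
open Matrix

/-- Closedness of the set of feasible growth rates for prokaryotic RBA. -/
theorem rba_feasible_growth_rates_closed {Ns Nm Np Ng Nb Nc : ℕ}
    (Ω : Matrix (Fin Ns) (Fin Nm) ℝ)
    (CYS : Matrix (Fin Ns) (Fin (Nm + Np)) ℝ)
    (CBS : Matrix (Fin Ns) (Fin Nb) ℝ)
    (CGS : Matrix (Fin Ns) (Fin Ng) ℝ)
    (CYM : Matrix (Fin Np) (Fin (Nm + Np)) ℝ)
    (CGM : Matrix (Fin Np) (Fin Ng) ℝ)
    (KT : Matrix (Fin Np) (Fin (Nm + Np)) ℝ)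
    (CYD : Matrix (Fin Nc) (Fin (Nm + Np)) ℝ)
    (CGD : Matrix (Fin Nc) (Fin Ng) ℝ)
    (k : Fin Nm → ℝ) (B : Fin Nb → ℝ) (PG : Fin Ng → ℝ) (Dbar : Fin Nc → ℝ)
    (hk : ∀ j, 0 ≤ k j) (hB : ∀ i, 0 ≤ B i) (hPG : ∀ i, 0 ≤ PG i)
    (hCGDPG : ∀ i, 0 ≤ (CGD.mulVec PG) i)
    (δ : ℝ) (hδ : 0 < δ)
    (hcover : ∀ j : Fin (Nm + Np), ∃ i : Fin Nc, δ ≤ CYD i j)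
    (hCYD : ∀ i j, 0 ≤ CYD i j) :
    IsClosed {μ : ℝ | 0 ≤ μ ∧
      (RBAFeas Ω CYS CBS CGS CYM CGM KT CYD CGD k B PG Dbar μ).Nonempty} := by
  choose f hf using hcover
  set b : Fin (Nm + Np) → ℝ := fun j => Dbar (f j) / δ with hb
  set c : Fin Nm → ℝ := fun j => k j * b (Fin.castAdd Np j) with hc
  let K : Set ((Fin (Nm + Np) → ℝ) × (Fin Nm → ℝ)) := Set.Icc 0 b ×ˢ Set.Icc (-c) c
  have hK : IsCompact K := isCompact_Icc.prod isCompact_Icc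
  have : CompactSpace K := isCompact_iff_compactSpace.mp hK
  let S : Set (ℝ × K) := {q | 0 ≤ q.1 ∧
    (q.2 : (Fin (Nm + Np) → ℝ) × (Fin Nm → ℝ)) ∈
      RBAFeas Ω CYS CBS CGS CYM CGM KT CYD CGD k B PG Dbar q.1}
  have hS : IsClosed S := by
    have c1 : Continuous fun q : ℝ × K => q.1 := continuous_fst
    have c2 : Continuous fun q : ℝ × K => q.2.1.1 := by fun_prop
    have c3 : Continuous fun q : ℝ × K => q.2.1.2 := by fun_prop
    have mv : ∀ {m n : ℕ} (A : Matrix (Fin m) (Fin n) ℝ) {g : ℝ × K → Fin n → ℝ},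
        Continuous g → Continuous fun q => A.mulVec (g q) :=
      fun A _ hg => continuous_const.matrix_mulVec hg
    have e1 := mv CYS c2
    have e2 := mv CYM c2
    have e3 := mv KT c2
    have e4 := mv CYD c2
    have e5 := mv Ω c3
    simp only [S, RBAFeas, Set.mem_ofPred_eq]
    simp only [Set.ofPred_and, Set.ofPred_forall]
    refine (isClosed_le continuous_const c1).inter (IsClosed.inter ?_ (IsClosed.inter ?_
      (IsClosed.inter ?_ (IsClosed.inter ?_ ?_))))
    · exact isClosed_iInter fun j => isClosed_le continuous_const ((continuous_apply j).comp c2)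
    · exact isClosed_eq (e5.add (c1.smul ((e1.add continuous_const).add continuous_const)))
        continuous_const
    · exact isClosed_iInter fun i => isClosed_le
        (c1.mul ((continuous_apply i).comp (e2.add continuous_const)))
        ((continuous_apply i).comp e3)
    · exact isClosed_iInter fun j => isClosed_le ((continuous_apply j).comp c3).abs
        (continuous_const.mul ((continuous_apply (Fin.castAdd Np j)).comp c2))
    · exact isClosed_iInter fun i => isClosed_le
        ((continuous_apply i).comp (e4.add continuous_const)) continuous_const
  have him := isClosedMap_fst_of_compactSpace S hS
  convert him using 1
  ext μ
  constructor
  · rintro ⟨hμ, p, hp⟩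
    have hp' := hp
    obtain ⟨h0, -, -, h3, h4⟩ := hp'
    have hYb : ∀ j, p.1 j ≤ b j := by
      intro j
      have h5 := h4 (f j)
      have h6 := hCGDPG (f j)
      have h7 : CYD (f j) j * p.1 j ≤ CYD.mulVec p.1 (f j) :=
        Finset.single_le_sum (f := fun l => CYD (f j) l * p.1 l)
          (fun l _ => mul_nonneg (hCYD _ _) (h0 l)) (Finset.mem_univ j)
      have h8 := mul_le_mul_of_nonneg_right (hf j) (h0 j)
      simp only [Pi.add_apply] at h5
      simp only [hb]
      rw [le_div_iff₀ hδ]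
      linarith
    have hνc : ∀ j, |p.2 j| ≤ c j := fun j =>
      (h3 j).trans (mul_le_mul_of_nonneg_left (hYb _) (hk j))
    have hpK : p ∈ K :=
      ⟨⟨h0, hYb⟩, ⟨fun j => (abs_le.mp (hνc j)).1, fun j => (abs_le.mp (hνc j)).2⟩⟩
    exact ⟨(μ, ⟨p, hpK⟩), ⟨hμ, hp⟩, rfl⟩
  · rintro ⟨⟨μ', p⟩, ⟨hμ, hp⟩, rfl⟩
    exact ⟨hμ, p.1, hp⟩
end
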